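/- If X is a finite-type-Dyck shift over a pushdown alphabet A, Y is a subshift of B^ℤ for a pushdown alphabet B, and there is a proper conjugacy from X onto Y, then Y is a finite-type-Dyck shift over B. -/

import Mathlib

namespace SD

/-- The three kinds of letters of a pushdown alphabet. -/
inductive LetterKind : Type
  | call
  | ret
  | intern
  deriving DecidableEq

/-- A pushdown alphabet structure on `A`: a partition of the letters into
call letters, return letters and internal letters. -/
structure PushdownAlphabet (A : Type*) where
  kind : A → LetterKind

/-- Number of call letters of a word. -/
def callCount {A : Type*} (P : PushdownAlphabet A) (u : List A) : ℕ :=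
  u.countP (fun a => decide (P.kind a = LetterKind.call))

/-- Number of return letters of a word. -/
def retCount {A : Type*} (P : PushdownAlphabet A) (u : List A) : ℕ :=
  u.countP (fun a => decide (P.kind a = LetterKind.ret))

/-- A word is matched-return if every prefix has at least as many call letters
as return letters. -/
def MatchedReturn {A : Type*} (P : PushdownAlphabet A) (u : List A) : Prop :=
  ∀ v w : List A, u = v ++ w → retCount P v ≤ callCount P v

/-- A word is matched-call if every suffix has at least as many return letters
as call letters. -/
def MatchedCall {A : Type*} (P : PushdownAlphabet A) (u : List A) : Prop :=
  ∀ v w : List A, u = v ++ w → callCount P w ≤ retCount P w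

/-- A Dyck word is a word which is both matched-return and matched-call. -/
def IsDyck {A : Type*} (P : PushdownAlphabet A) (u : List A) : Prop :=
  MatchedReturn P u ∧ MatchedCall P u

/-- The factor of length `n` of a bi-infinite sequence starting at position `i`. -/
def factorAt {A : Type*} (x : ℤ → A) (i : ℤ) (n : ℕ) : List A :=
  (List.range n).map (fun k => x (i + (k : ℤ)))

/-- `w` is a (finite) factor of the bi-infinite sequence `x`. -/
def IsFactorOf {A : Type*} (w : List A) (x : ℤ → A) : Prop :=
  ∃ i : ℤ, w = factorAt x i w.length

/-- A Dyck automaton over alphabet `A` with states `Q`: a labeled graph together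
with a set of matched pairs of edges. -/
structure DyckAutomaton (A : Type*) (Q : Type*) where
  edges : Set (Q × A × Q)
  matched : Set ((Q × A × Q) × (Q × A × Q))

/-- Well-formedness of a Dyck automaton: matched pairs consist of edges of the
automaton, a call edge followed by a return edge. -/
def DyckAutomaton.WellFormed {A Q : Type*} (P : PushdownAlphabet A)
    (𝒜 : DyckAutomaton A Q) : Prop :=
  ∀ e f : Q × A × Q, (e, f) ∈ 𝒜.matched →
    e ∈ 𝒜.edges ∧ f ∈ 𝒜.edges ∧
    P.kind e.2.1 = LetterKind.call ∧ P.kind f.2.1 = LetterKind.ret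

/-- The label of a finite path. -/
def pathLabel {A Q : Type*} (π : List (Q × A × Q)) : List A :=
  π.map (fun e => e.2.1)

/-- A finite path of the underlying graph: a sequence of consecutive edges. -/
def IsPath {A Q : Type*} (𝒜 : DyckAutomaton A Q) (π : List (Q × A × Q)) : Prop :=
  (∀ e ∈ π, e ∈ 𝒜.edges) ∧ π.Chain' (fun e f => e.2.2 = f.1)

/-- A finite path is admissible if for any factor `e · π₁ · f` of it with `e` a call
edge, `f` a return edge and the label of `π₁` a Dyck word, `(e,f)` is a matched pair. -/
def IsAdmissible {A Q : Type*} (P : PushdownAlphabet A) (𝒜 : DyckAutomaton A Q)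
    (π : List (Q × A × Q)) : Prop :=
  IsPath 𝒜 π ∧
  ∀ (π₀ : List (Q × A × Q)) (e : Q × A × Q) (π₁ : List (Q × A × Q)) (f : Q × A × Q)
    (π₂ : List (Q × A × Q)), π = π₀ ++ e :: π₁ ++ f :: π₂ →
    P.kind e.2.1 = LetterKind.call → P.kind f.2.1 = LetterKind.ret →
    IsDyck P (pathLabel π₁) → (e, f) ∈ 𝒜.matched

/-- The finite factor of a bi-infinite path starting at index `i`, of length `n`. -/
def pathSeg {A Q : Type*} (π : ℤ → Q × A × Q) (i : ℤ) (n : ℕ) : List (Q × A × Q) :=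
  (List.range n).map (fun k => π (i + (k : ℤ)))

/-- A bi-infinite path is admissible if it is a bi-infinite path of the graph all of
whose finite factors are admissible. -/
def BiAdmissible {A Q : Type*} (P : PushdownAlphabet A) (𝒜 : DyckAutomaton A Q)
    (π : ℤ → Q × A × Q) : Prop :=
  (∀ i : ℤ, π i ∈ 𝒜.edges) ∧ (∀ i : ℤ, (π i).2.2 = (π (i + 1)).1) ∧
  ∀ (i : ℤ) (n : ℕ), IsAdmissible P 𝒜 (pathSeg π i n)

/-- The sofic-Dyck shift presented by a Dyck automaton: the set of labels of
bi-infinite admissible paths. -/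
def presents {A Q : Type*} (P : PushdownAlphabet A) (𝒜 : DyckAutomaton A Q) :
    Set (ℤ → A) :=
  { x | ∃ π : ℤ → Q × A × Q, BiAdmissible P 𝒜 π ∧ ∀ i : ℤ, (π i).2.1 = x i }

/-- A sofic-Dyck shift over `A`: a set presented by some (finite, well-formed)
Dyck automaton. -/
def IsSoficDyck {A : Type*} (P : PushdownAlphabet A) (X : Set (ℤ → A)) : Prop :=
  ∃ (N : ℕ) (𝒜 : DyckAutomaton A (Fin N)), 𝒜.WellFormed P ∧ X = presents P 𝒜

/-- A finite path goes from `p` to `q` (an empty path goes from `p` to `p`). -/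
def GoesFromTo {A Q : Type*} (π : List (Q × A × Q)) (p q : Q) : Prop :=
  (∀ e ∈ π.head?, e.1 = p) ∧ (∀ e ∈ π.getLast?, e.2.2 = q) ∧ (π = [] → p = q)

/-- A finite path starts at state `p`. -/
def StartsAt {A Q : Type*} (π : List (Q × A × Q)) (p : Q) : Prop :=
  ∀ e ∈ π.head?, e.1 = p

/-- A bi-infinite sequence avoids a set `F` of finite words if no finite factor of it
belongs to `F`. -/
def AvoidsWords {A : Type*} (F : Set (List A)) (x : ℤ → A) : Prop :=
  ∀ w : List A, IsFactorOf w x → w ∉ F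

/-- A bi-infinite sequence avoids a set `U` of pairs `((u₁,a,u₂),(v₁,b,v₂))` if for
every finite factor `v·a·w·b·z` of it with `a` call, `b` return and `w` a Dyck word,
no pair `((u₁,a,u₂),(v₁,b,v₂)) ∈ U` satisfies `(u₁,u₂) ⪯ (v, w·b·z)` and
`(v₁,v₂) ⪯ (v·a·w, z)`. -/
def AvoidsPairs {A : Type*} (P : PushdownAlphabet A)
    (U : Set ((List A × A × List A) × (List A × A × List A))) (x : ℤ → A) : Prop :=
  ∀ (v : List A) (a : A) (w : List A) (b : A) (z : List A),
    IsFactorOf (v ++ a :: w ++ b :: z) x →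
    P.kind a = LetterKind.call → P.kind b = LetterKind.ret → IsDyck P w →
    ∀ u₁ u₂ v₁ v₂ : List A, ((u₁, a, u₂), (v₁, b, v₂)) ∈ U →
      ¬(u₁ <:+ v ∧ u₂ <+: w ++ b :: z ∧ v₁ <:+ v ++ a :: w ∧ v₂ <+: z)

/-- A finite-type-Dyck shift over `A`: the set of bi-infinite sequences avoiding two
finite sets `F` and `U`. -/
def IsFiniteTypeDyck {A : Type*} (P : PushdownAlphabet A) (X : Set (ℤ → A)) : Prop :=
  ∃ (F : Set (List A)) (U : Set ((List A × A × List A) × (List A × A × List A))),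
    F.Finite ∧ U.Finite ∧
    (∀ u ∈ U, P.kind u.1.2.1 = LetterKind.call ∧ P.kind u.2.2.1 = LetterKind.ret) ∧
    X = { x | AvoidsWords F x ∧ AvoidsPairs P U x }

/-- `Φ` is an `(m,n)`-block map on `X` for some `m, n`: there is a block function `φ`
with `Φ(x)_i = φ(x_{i-m} ⋯ x_{i+n})` for all `x ∈ X` and `i ∈ ℤ`. -/
def IsBlockMapOn {A B : Type*} (X : Set (ℤ → A)) (Φ : (ℤ → A) → ℤ → B) : Prop :=
  ∃ (m n : ℕ) (φ : List A → B),
    ∀ x ∈ X, ∀ i : ℤ, Φ x i = φ (factorAt x (i - (m : ℤ)) (m + n + 1))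

/-- A map is proper on `X` if it sends call (resp. return, internal) letters to
call (resp. return, internal) letters. -/
def IsProperOn {A B : Type*} (P : PushdownAlphabet A) (PB : PushdownAlphabet B)
    (X : Set (ℤ → A)) (Φ : (ℤ → A) → ℤ → B) : Prop :=
  ∀ x ∈ X, ∀ i : ℤ, PB.kind (Φ x i) = P.kind (x i)

end SD

open SD

namespace SD

theorem factorAt_eq_map {A : Type*} (x : ℤ → A) (i : ℤ) (n : ℕ) :
    factorAt x i n = (List.range n).map fun k : ℕ => x (i + k) := by
  simp [factorAt, ← List.map_eq_flatMap]

theorem factorAt_eq_factorAt_iff {A : Type*} {x x' : ℤ → A} {i i' : ℤ} {n : ℕ} :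
    factorAt x i n = factorAt x' i' n ↔ ∀ k : ℕ, k < n → x (i + k) = x' (i' + k) := by
  simp [factorAt_eq_map]

@[simp]
theorem length_factorAt {A : Type*} (x : ℤ → A) (i : ℤ) (n : ℕ) :
    (factorAt x i n).length = n := by
  simp [factorAt_eq_map]

theorem factorAt_add {A : Type*} (x : ℤ → A) (i : ℤ) (k l : ℕ) :
    factorAt x i (k + l) = factorAt x i k ++ factorAt x (i + k) l := by
  simp [factorAt_eq_map, List.range_add, add_assoc]

theorem factorAt_succ {A : Type*} (x : ℤ → A) (i : ℤ) (n : ℕ) :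
    factorAt x i (n + 1) = x i :: factorAt x (i + 1) n := by
  rw [add_comm, factorAt_add]
  simp [factorAt_eq_map]

/-- The word `w` occurs in `x` at position `i`. -/
def OccursAt {A : Type*} (w : List A) (x : ℤ → A) (i : ℤ) : Prop :=
  w = factorAt x i w.length

theorem occursAt_append {A : Type*} {u v : List A} {x : ℤ → A} {i : ℤ} :
    OccursAt (u ++ v) x i ↔ OccursAt u x i ∧ OccursAt v x (i + u.length) := by
  unfold OccursAt
  rw [List.length_append, factorAt_add]
  refine ⟨fun h => List.append_inj h (by simp), fun ⟨h₁, h₂⟩ => ?_⟩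
  rw [← h₁, ← h₂]

theorem occursAt_cons {A : Type*} {a : A} {v : List A} {x : ℤ → A} {i : ℤ} :
    OccursAt (a :: v) x i ↔ a = x i ∧ OccursAt v x (i + 1) := by
  unfold OccursAt
  rw [List.length_cons, factorAt_succ, List.cons.injEq]

theorem occursAt_factorAt {A : Type*} (x : ℤ → A) (i : ℤ) (n : ℕ) :
    OccursAt (factorAt x i n) x i := by
  simp [OccursAt]

theorem OccursAt.of_suffix {A : Type*} {u v : List A} {x : ℤ → A} {i : ℤ}
    (h : OccursAt v x (i - v.length)) (huv : u <:+ v) : OccursAt u x (i - u.length) := by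
  obtain ⟨t, rfl⟩ := huv
  have := (occursAt_append.1 h).2
  rw [List.length_append] at this
  convert this using 1
  push_cast
  ring

theorem OccursAt.of_prefix {A : Type*} {u v : List A} {x : ℤ → A} {i : ℤ}
    (h : OccursAt v x i) (huv : u <+: v) : OccursAt u x i := by
  obtain ⟨t, rfl⟩ := huv
  exact (occursAt_append.1 h).1

theorem OccursAt.isPrefix {A : Type*} {u v : List A} {x : ℤ → A} {i : ℤ}
    (hu : OccursAt u x i) (hv : OccursAt v x i) (h : u.length ≤ v.length) : u <+: v := by
  obtain ⟨l, hl⟩ := Nat.exists_eq_add_of_le h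
  rw [hu, hv, hl, factorAt_add]
  simp

theorem OccursAt.isSuffix {A : Type*} {u v : List A} {x : ℤ → A} {i : ℤ}
    (hu : OccursAt u x (i - u.length)) (hv : OccursAt v x (i - v.length))
    (h : u.length ≤ v.length) : u <:+ v := by
  obtain ⟨l, hl⟩ := Nat.exists_eq_add_of_le' h
  rw [hu, hv, hl, factorAt_add, show i - ((l + u.length : ℕ) : ℤ) + l = i - u.length by
    push_cast; ring]
  simp

/-- The pointed word `(u, a, v)` occurs in `x` with its letter `a` at position `i`. -/
def ContextAt {A : Type*} (c : List A × A × List A) (x : ℤ → A) (i : ℤ) : Prop :=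
  OccursAt c.1 x (i - c.1.length) ∧ c.2.1 = x i ∧ OccursAt c.2.2 x (i + 1)

/-- The pointed word of `x` at position `i` with `K` letters on each side. -/
def context {A : Type*} (K : ℕ) (x : ℤ → A) (i : ℤ) : List A × A × List A :=
  (factorAt x (i - K) K, x i, factorAt x (i + 1) K)

/-- `x` has matched call and return letters at positions `i` and `i + 1 + n`. -/
def MatchedAt {A : Type*} (P : PushdownAlphabet A) (x : ℤ → A) (i : ℤ) (n : ℕ) : Prop :=
  P.kind (x i) = LetterKind.call ∧ P.kind (x (i + 1 + n)) = LetterKind.ret ∧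
    IsDyck P (factorAt x (i + 1) n)

/-- Avoiding a set of pairs, expressed through positions of matched letters. -/
theorem avoidsPairs_iff {A : Type*} {P : PushdownAlphabet A}
    {U : Set ((List A × A × List A) × (List A × A × List A))} {x : ℤ → A} :
    AvoidsPairs P U x ↔ ∀ (i : ℤ) (n : ℕ), MatchedAt P x i n →
      ∀ u ∈ U, ¬(ContextAt u.1 x i ∧ ContextAt u.2 x (i + 1 + n)) := by
  constructor
  · rintro h i n ⟨ha, hb, hw⟩ ⟨⟨u₁, a, u₂⟩, v₁, b, v₂⟩ hu ⟨⟨h₁, rfl, h₂⟩, h₃, rfl, h₄⟩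
    simp only at h₁ h₂ h₃ h₄
    set N := u₁.length + u₂.length + v₁.length + v₂.length
    have hv : OccursAt (factorAt x (i - N) N) x (i - N) := occursAt_factorAt ..
    have hwo : OccursAt (factorAt x (i + 1) n) x (i + 1) := occursAt_factorAt ..
    have hz : OccursAt (factorAt x (i + 1 + n + 1) N) x (i + 1 + n + 1) := occursAt_factorAt ..
    have hwbz : OccursAt (factorAt x (i + 1) n ++ x (i + 1 + n) ::
        factorAt x (i + 1 + n + 1) N) x (i + 1) := by
      simpa [occursAt_append, occursAt_cons] using ⟨hwo, hz⟩
    have hvaw : OccursAt (factorAt x (i - N) N ++ x i :: factorAt x (i + 1) n) x (i - N) := by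
      simpa [occursAt_append, occursAt_cons] using ⟨hv, hwo⟩
    refine h (factorAt x (i - N) N) (x i) (factorAt x (i + 1) n) (x (i + 1 + n))
      (factorAt x (i + 1 + n + 1) N) ⟨i - N, ?_⟩ ha hb hw u₁ u₂ v₁ v₂ hu ⟨?_, ?_, ?_, ?_⟩
    · change OccursAt _ x _
      rw [List.append_assoc, occursAt_append]
      refine ⟨hv, ?_⟩
      simpa [occursAt_cons] using hwbz
    · exact h₁.isSuffix (by simpa using hv) (by simp; omega)
    · exact h₂.isPrefix hwbz (by simp; omega)
    · refine h₃.isSuffix ?_ (by simp; omega)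
      convert hvaw using 1
      simp
      ring
    · exact h₄.isPrefix hz (by simp; omega)
  · rintro h v a w b z ⟨k, hk⟩ ha hb hw u₁ u₂ v₁ v₂ hu ⟨h₁, h₂, h₃, h₄⟩
    change OccursAt _ x k at hk
    have hvaw := (occursAt_append.1 hk).1
    have hbz := (occursAt_append.1 hk).2
    rw [List.append_assoc, occursAt_append, List.cons_append, occursAt_cons] at hk
    obtain ⟨hv, rfl, hwbz⟩ := hk
    have hw' := (occursAt_append.1 hwbz).1
    obtain ⟨rfl, hz⟩ := occursAt_cons.1 (occursAt_append.1 hwbz).2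
    refine h (k + v.length) w.length ⟨ha, hb, ?_⟩ _ hu
      ⟨⟨OccursAt.of_suffix (by simpa using hv) h₁, rfl, hwbz.of_prefix h₂⟩,
        OccursAt.of_suffix ?_ h₃, rfl, hz.of_prefix h₄⟩
    · rwa [← show w = _ from hw']
    · convert hvaw using 1
      simp
      ring

theorem callCount_eq_of_map_kind_eq {A B : Type*} {P : PushdownAlphabet A}
    {PB : PushdownAlphabet B} {u : List A} {v : List B}
    (h : u.map P.kind = v.map PB.kind) : callCount P u = callCount PB v := by
  simpa [callCount, List.countP_map, Function.comp_def] using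
    congrArg (List.countP fun k => decide (k = LetterKind.call)) h

theorem retCount_eq_of_map_kind_eq {A B : Type*} {P : PushdownAlphabet A}
    {PB : PushdownAlphabet B} {u : List A} {v : List B}
    (h : u.map P.kind = v.map PB.kind) : retCount P u = retCount PB v := by
  simpa [retCount, List.countP_map, Function.comp_def] using
    congrArg (List.countP fun k => decide (k = LetterKind.ret)) h

theorem IsDyck.of_map_kind_eq {A B : Type*} {P : PushdownAlphabet A}
    {PB : PushdownAlphabet B} {u : List A} {v : List B}
    (h : u.map P.kind = v.map PB.kind) (hu : IsDyck P u) : IsDyck PB v := by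
  constructor
  · rintro s t rfl
    rw [List.map_append, List.map_eq_append_iff] at h
    obtain ⟨s', t', rfl, hs, ht⟩ := h
    rw [← retCount_eq_of_map_kind_eq hs, ← callCount_eq_of_map_kind_eq hs]
    exact hu.1 s' t' rfl
  · rintro s t rfl
    rw [List.map_append, List.map_eq_append_iff] at h
    obtain ⟨s', t', rfl, hs, ht⟩ := h
    rw [← retCount_eq_of_map_kind_eq ht, ← callCount_eq_of_map_kind_eq ht]
    exact hu.2 s' t' rfl

theorem MatchedAt.of_kind_eq {A B : Type*} {P : PushdownAlphabet A}
    {PB : PushdownAlphabet B} {x : ℤ → A} {y : ℤ → B}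
    (h : ∀ i, P.kind (x i) = PB.kind (y i)) {i : ℤ} {n : ℕ} (hx : MatchedAt P x i n) :
    MatchedAt PB y i n :=
  ⟨h _ ▸ hx.1, h _ ▸ hx.2.1, hx.2.2.of_map_kind_eq (by simp [factorAt_eq_map, h])⟩

/-- `x` around `i` agrees with `x'` around `i'` up to distance `K`. -/
def AgreeNear {A : Type*} (K : ℕ) (x : ℤ → A) (i : ℤ) (x' : ℤ → A) (i' : ℤ) : Prop :=
  ∀ k : ℤ, -K ≤ k → k ≤ K → x (i + k) = x' (i' + k)

theorem AgreeNear.symm {A : Type*} {K : ℕ} {x x' : ℤ → A} {i i' : ℤ}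
    (h : AgreeNear K x i x' i') : AgreeNear K x' i' x i :=
  fun k h₁ h₂ => (h k h₁ h₂).symm

theorem AgreeNear.mono {A : Type*} {K K' : ℕ} {x x' : ℤ → A} {i i' : ℤ}
    (h : AgreeNear K x i x' i') (hK : K' ≤ K) : AgreeNear K' x i x' i' :=
  fun k h₁ h₂ => h k (by omega) (by omega)

theorem AgreeNear.eq {A : Type*} {K : ℕ} {x x' : ℤ → A} {i i' : ℤ}
    (h : AgreeNear K x i x' i') : x i = x' i' := by
  simpa using h 0 (by omega) (by omega)

theorem AgreeNear.factorAt_eq {A : Type*} {K : ℕ} {x x' : ℤ → A} {i i' : ℤ}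
    (h : AgreeNear K x i x' i') {s : ℤ} {l : ℕ} (hs : -K ≤ s) (hl : s + l ≤ K + 1) :
    factorAt x (i + s) l = factorAt x' (i' + s) l := by
  rw [factorAt_eq_factorAt_iff]
  intro k hk
  rw [add_assoc, add_assoc]
  exact h _ (by omega) (by omega)

theorem agreeNear_of_factorAt_eq {A : Type*} {K : ℕ} {x x' : ℤ → A} {i i' : ℤ}
    (h : factorAt x (i - K) (2 * K + 1) = factorAt x' (i' - K) (2 * K + 1)) :
    AgreeNear K x i x' i' := by
  rw [factorAt_eq_factorAt_iff] at h
  intro k h₁ h₂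
  have := h (k + K).toNat (by omega)
  rwa [Int.toNat_of_nonneg (by omega), show i - K + (k + K) = i + k by ring,
    show i' - K + (k + K) = i' + k by ring] at this

theorem AgreeNear.contextAt {A : Type*} {K : ℕ} {x x' : ℤ → A} {i i' : ℤ}
    (h : AgreeNear K x i x' i') {c : List A × A × List A} (h₁ : c.1.length ≤ K)
    (h₂ : c.2.2.length ≤ K) (hc : ContextAt c x i) : ContextAt c x' i' := by
  obtain ⟨hl, hm, hr⟩ := hc
  refine ⟨hl.trans ?_, hm.trans h.eq, hr.trans (h.factorAt_eq (by omega) (by omega))⟩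
  rw [sub_eq_add_neg, sub_eq_add_neg]
  exact h.factorAt_eq (by omega) (by omega)

theorem contextAt_context {A : Type*} (K : ℕ) (x : ℤ → A) (i : ℤ) :
    ContextAt (context K x i) x i := by
  simp [ContextAt, context, OccursAt]

theorem ContextAt.agreeNear {A : Type*} {K : ℕ} {x x' : ℤ → A} {i i' : ℤ}
    (h : ContextAt (context K x' i') x i) : AgreeNear K x i x' i' := by
  apply agreeNear_of_factorAt_eq
  obtain ⟨hl, hm, hr⟩ := h
  simp only [context, OccursAt, length_factorAt] at hl hm hr
  rw [show 2 * K + 1 = K + (K + 1) by ring]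
  simp only [factorAt_add _ _ K (K + 1), factorAt_succ, sub_add_cancel, hl, hm, hr]

/-- The sliding block code on the full shift with block function `φ`. -/
def slidingBlock {A B : Type*} (m n : ℕ) (φ : List A → B) (x : ℤ → A) (i : ℤ) : B :=
  φ (factorAt x (i - m) (m + n + 1))

theorem AgreeNear.slidingBlock {A B : Type*} {K m n : ℕ} (φ : List A → B) {x x' : ℤ → A}
    {i i' : ℤ} (h : AgreeNear (K + m + n) x i x' i') :
    AgreeNear K (slidingBlock m n φ x) i (slidingBlock m n φ x') i' := by
  intro k h₁ h₂
  unfold SD.slidingBlock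
  rw [add_sub_assoc, add_sub_assoc, h.factorAt_eq (by push_cast; omega) (by push_cast; omega)]

theorem finite_range_context (A : Type*) [Finite A] (K : ℕ) :
    {c : List A × A × List A | ∃ x i, c = context K x i}.Finite := by
  refine ((List.finite_length_eq A K).prod
    (Set.finite_univ.prod (List.finite_length_eq A K))).subset ?_
  rintro _ ⟨x, i, rfl⟩
  simp [context]

/-- The words of length `2 * L + 1` which are not factors of any element of `Y`. -/
def nonFactors {B : Type*} (Y : Set (ℤ → B)) (L : ℕ) : Set (List B) :=
  {w | w.length = 2 * L + 1 ∧ ∀ y ∈ Y, ¬IsFactorOf w y}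

theorem finite_nonFactors {B : Type*} [Finite B] (Y : Set (ℤ → B)) (L : ℕ) :
    (nonFactors Y L).Finite :=
  (List.finite_length_eq B (2 * L + 1)).subset fun _ hw => hw.1

theorem avoidsWords_nonFactors {B : Type*} {Y : Set (ℤ → B)} {L : ℕ} {y : ℤ → B}
    (hy : y ∈ Y) : AvoidsWords (nonFactors Y L) y :=
  fun _ hw h => h.2 y hy hw

theorem AvoidsWords.exists_agreeNear {B : Type*} {Y : Set (ℤ → B)} {L : ℕ} {y : ℤ → B}
    (h : AvoidsWords (nonFactors Y L) y) (i : ℤ) :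
    ∃ y' ∈ Y, ∃ i' : ℤ, AgreeNear L y i y' i' := by
  have := h (factorAt y (i - L) (2 * L + 1)) ⟨i - L, by simp⟩
  simp only [nonFactors, Set.mem_ofPred_eq, length_factorAt, true_and, not_forall,
    not_not] at this
  obtain ⟨y', hy', k, hk⟩ := this
  refine ⟨y', hy', k + L, agreeNear_of_factorAt_eq ?_⟩
  simpa using hk

/-- The pairs of pointed words of radius `L` around a call and a return letter whose image under
the block map `G` exhibits a pair of `U`. -/
def pullbackPairs {A B : Type*} (PB : PushdownAlphabet B)
    (U : Set ((List A × A × List A) × (List A × A × List A)))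
    (G : (ℤ → B) → ℤ → A) (L : ℕ) : Set ((List B × B × List B) × (List B × B × List B)) :=
  {p | ∃ (y y' : ℤ → B) (i j : ℤ), p = (context L y i, context L y' j) ∧
    PB.kind (y i) = LetterKind.call ∧ PB.kind (y' j) = LetterKind.ret ∧
    ∃ u ∈ U, ContextAt u.1 (G y) i ∧ ContextAt u.2 (G y') j}

theorem finite_pullbackPairs {A B : Type*} [Finite B] (PB : PushdownAlphabet B)
    (U : Set ((List A × A × List A) × (List A × A × List A)))
    (G : (ℤ → B) → ℤ → A) (L : ℕ) : (pullbackPairs PB U G L).Finite := by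
  refine ((finite_range_context B L).prod (finite_range_context B L)).subset ?_
  rintro _ ⟨y, y', i, j, rfl, -⟩
  exact ⟨⟨y, i, rfl⟩, ⟨y', j, rfl⟩⟩

end SD

/-- The class of finite-type-Dyck shifts is invariant under proper conjugacy. -/
theorem statement_7 {A B : Type*} [Fintype A] [Fintype B]
    [TopologicalSpace B] [DiscreteTopology B]
    (P : PushdownAlphabet A) (PB : PushdownAlphabet B)
    (X : Set (ℤ → A)) (Y : Set (ℤ → B))
    (hX : IsFiniteTypeDyck P X)
    (hYinv : (fun y : ℤ → B => fun i : ℤ => y (i + 1)) '' Y = Y) (hYclosed : IsClosed Y)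
    (Φ : (ℤ → A) → ℤ → B) (Ψ : (ℤ → B) → ℤ → A)
    (hΦ : IsBlockMapOn X Φ) (hΦp : IsProperOn P PB X Φ)
    (hΨ : IsBlockMapOn Y Ψ) (hΨp : IsProperOn PB P Y Ψ)
    (him : Φ '' X = Y) (hli : ∀ x ∈ X, Ψ (Φ x) = x) (hri : ∀ y ∈ Y, Φ (Ψ y) = y) :
    IsFiniteTypeDyck PB Y := by
  obtain ⟨F, U, hF, hU, -, rfl⟩ := hX
  obtain ⟨m, n, φ, hφ⟩ := hΦ
  obtain ⟨m', n', ψ, hψ⟩ := hΨ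
  obtain ⟨N₁, hN₁⟩ : ∃ N, ∀ w ∈ F, w.length ≤ N := by
    obtain ⟨N, hN⟩ := (hF.image List.length).bddAbove
    exact ⟨N, fun w hw => hN ⟨w, hw, rfl⟩⟩
  obtain ⟨N₂, hN₂⟩ : ∃ N, ∀ u ∈ U, u.1.1.length + u.1.2.2.length +
      (u.2.1.length + u.2.2.2.length) ≤ N := by
    obtain ⟨N, hN⟩ := (hU.image fun u => u.1.1.length + u.1.2.2.length +
      (u.2.1.length + u.2.2.2.length)).bddAbove
    exact ⟨N, fun u hu => hN ⟨u, hu, rfl⟩⟩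
  set X := {x | AvoidsWords F x ∧ AvoidsPairs P U x}
  set G := slidingBlock m' n' ψ
  set L := N₁ + N₂ + m + n + m' + n' with hL
  have hGY : ∀ y ∈ Y, G y = Ψ y := fun y hy => funext fun i => (hψ y hy i).symm
  have hΨX : ∀ y ∈ Y, Ψ y ∈ X := by
    intro y hy
    obtain ⟨x, hx, rfl⟩ := him.symm ▸ hy
    rwa [hli x hx]
  have hnear : ∀ {y y' : ℤ → B} {i i' : ℤ}, AgreeNear L y i y' i' →
      AgreeNear (N₁ + N₂ + m + n) (G y) i (G y') i' := fun h => h.slidingBlock ψ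
  have hkind : ∀ y, AvoidsWords (nonFactors Y L) y → ∀ i, P.kind (G y i) = PB.kind (y i) := by
    intro y hy i
    obtain ⟨y', hy', i', h⟩ := hy.exists_agreeNear i
    rw [(hnear h).eq, h.eq, hGY y' hy', hΨp y' hy']
  refine ⟨nonFactors Y L, pullbackPairs PB U G L, finite_nonFactors Y L,
    finite_pullbackPairs PB U G L, ?_, Set.Subset.antisymm ?_ ?_⟩
  · rintro _ ⟨y, y', i, j, rfl, hi, hj, -⟩
    exact ⟨hi, hj⟩
  · intro y hy
    have hyF : AvoidsWords (nonFactors Y L) y := avoidsWords_nonFactors hy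
    refine ⟨hyF, avoidsPairs_iff.2 ?_⟩
    rintro i l hil _ ⟨z, z', k, k', rfl, -, -, u, hu, h₁, h₂⟩ ⟨hc₁, hc₂⟩
    have hu' := hN₂ u hu
    have hx : AvoidsPairs P U (G y) := by
      rw [hGY y hy]
      exact (hΨX y hy).2
    exact avoidsPairs_iff.1 hx i l (hil.of_kind_eq fun i => (hkind y hyF i).symm) u hu
      ⟨(hnear hc₁.agreeNear.symm).contextAt (by omega) (by omega) h₁,
        (hnear hc₂.agreeNear.symm).contextAt (by omega) (by omega) h₂⟩
  · rintro y ⟨hyF, hyU⟩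
    have hGX : G y ∈ X := by
      refine ⟨?_, avoidsPairs_iff.2 ?_⟩
      · rintro w ⟨i, hi⟩ hw
        have hw' := hN₁ w hw
        obtain ⟨y', hy', i', h⟩ := hyF.exists_agreeNear i
        refine (hΨX y' hy').1 w ⟨i', ?_⟩ hw
        rw [← hGY y' hy']
        have := (hnear h).factorAt_eq (s := 0) (l := w.length) (by omega) (by omega)
        simp only [add_zero] at this
        exact hi.trans this
      · rintro i l hil u hu ⟨h₁, h₂⟩
        have hil' : MatchedAt PB y i l := hil.of_kind_eq (hkind y hyF)
        exact avoidsPairs_iff.1 hyU i l hil' (context L y i, context L y (i + 1 + l))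
          ⟨y, y, i, i + 1 + l, rfl, hil'.1, hil'.2.1, u, hu, h₁, h₂⟩
          ⟨contextAt_context L y i, contextAt_context L y (i + 1 + l)⟩
    rw [← him]
    refine ⟨G y, hGX, funext fun i => ?_⟩
    obtain ⟨y', hy', i', h⟩ := hyF.exists_agreeNear i
    calc Φ (G y) i = slidingBlock m n φ (G y) i := hφ _ hGX i
      _ = slidingBlock m n φ (G y') i' :=
        (((hnear h).mono (K' := 0 + m + n) (by omega)).slidingBlock φ).eq
      _ = Φ (Ψ y') i' := by
        rw [hGY y' hy']
        exact (hφ _ (hΨX y' hy') i').symm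
      _ = y' i' := by rw [hri y' hy']
      _ = y i := h.eq.symm
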